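/- Let k ≥ 3 be an integer. A digraph D has dichromatic number χ⃗(D) ≥ k if and only if D is Ore-k-constructible. -/

import Mathlib

/-- A finite digraph on the vertex type `ℕ`: a finite vertex set together with a
finite set of arcs (ordered pairs of vertices), loopless, without parallel arcs
(but opposite arcs between two vertices are allowed). -/
structure Digr where
  verts : Finset ℕ
  arcs : Finset (ℕ × ℕ)
  arcs_sub : ∀ a ∈ arcs, a.1 ∈ verts ∧ a.2 ∈ verts
  no_loops : ∀ a ∈ arcs, a.1 ≠ a.2

namespace Digr

/-- `D'` is a subdigraph of `D`. -/
def Sub (D' D : Digr) : Prop := D'.verts ⊆ D.verts ∧ D'.arcs ⊆ D.arcs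

/-- An acyclic coloring of `D` with `n` colors: no directed cycle is monochromatic.
A monochromatic directed cycle through `v` is exactly a nontrivial closed walk from `v`
to `v` along arcs whose endpoints always get equal colors. -/
def GoodColoring (D : Digr) (n : ℕ) (φ : ℕ → Fin n) : Prop :=
  ∀ v, ¬ Relation.TransGen (fun x y => (x, y) ∈ D.arcs ∧ φ x = φ y) v v

/-- `D` admits an acyclic coloring with `n` colors. -/
def Colorable (D : Digr) (n : ℕ) : Prop := ∃ φ : ℕ → Fin n, D.GoodColoring n φ

/-- The dichromatic number of `D`. -/
noncomputable def dichrom (D : Digr) : ℕ := sInf {n | D.Colorable n}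

/-- `D` is `k`-critical: its dichromatic number is `k` and every proper subdigraph
has smaller dichromatic number. -/
def Critical (k : ℕ) (D : Digr) : Prop :=
  D.dichrom = k ∧ ∀ D' : Digr, D'.Sub D → D' ≠ D → D'.dichrom < k

/-- Deletion of a vertex. -/
def delete (D : Digr) (v : ℕ) : Digr where
  verts := D.verts.erase v
  arcs := D.arcs.filter (fun a => a.1 ≠ v ∧ a.2 ≠ v)
  arcs_sub := by
    intro a ha
    rw [Finset.mem_filter] at ha
    obtain ⟨ha, h1, h2⟩ := ha
    have h := D.arcs_sub a ha
    exact ⟨Finset.mem_erase.mpr ⟨h1, h.1⟩, Finset.mem_erase.mpr ⟨h2, h.2⟩⟩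
  no_loops := fun a ha => D.no_loops a (Finset.mem_filter.mp ha).1

/-- The subdigraph of `D` induced by a set `S` of vertices. -/
def induce (D : Digr) (S : Finset ℕ) : Digr where
  verts := D.verts ∩ S
  arcs := D.arcs.filter (fun a => a.1 ∈ S ∧ a.2 ∈ S)
  arcs_sub := by
    intro a ha
    rw [Finset.mem_filter] at ha
    obtain ⟨ha, h1, h2⟩ := ha
    have h := D.arcs_sub a ha
    exact ⟨Finset.mem_inter.mpr ⟨h.1, h1⟩, Finset.mem_inter.mpr ⟨h.2, h2⟩⟩
  no_loops := fun a ha => D.no_loops a (Finset.mem_filter.mp ha).1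

/-- Out-neighborhood of `v` in `D`. -/
def outNbrs (D : Digr) (v : ℕ) : Finset ℕ := D.verts.filter (fun y => (v, y) ∈ D.arcs)

/-- In-neighborhood of `v` in `D`. -/
def inNbrs (D : Digr) (v : ℕ) : Finset ℕ := D.verts.filter (fun x => (x, v) ∈ D.arcs)

/-- Out-degree. -/
def outDeg (D : Digr) (v : ℕ) : ℕ := (D.outNbrs v).card

/-- In-degree. -/
def inDeg (D : Digr) (v : ℕ) : ℕ := (D.inNbrs v).card

/-- `D` is (weakly) connected, i.e. its underlying graph is connected. -/
def Conn (D : Digr) : Prop :=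
  ∀ x ∈ D.verts, ∀ y ∈ D.verts,
    Relation.ReflTransGen (fun a b => (a, b) ∈ D.arcs ∨ (b, a) ∈ D.arcs) x y

/-- `D` is strongly connected. -/
def StronglyConn (D : Digr) : Prop :=
  ∀ x ∈ D.verts, ∀ y ∈ D.verts,
    Relation.ReflTransGen (fun a b => (a, b) ∈ D.arcs) x y

/-- `H` has no separating vertex. -/
def NoSepVertex (H : Digr) : Prop := ∀ v ∈ H.verts, (H.delete v).Conn

/-- `B` is a block of `D`: a maximal connected subdigraph of `D` without a
separating vertex. -/
def IsBlock (B D : Digr) : Prop :=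
  B.Sub D ∧ B.Conn ∧ B.NoSepVertex ∧
    ∀ B' : Digr, B'.Sub D → B'.Conn → B'.NoSepVertex → B.Sub B' → B' = B

/-- `B` is a directed cycle (of length ≥ 2). -/
def IsDirCycle (B : Digr) : Prop :=
  ∃ (n : ℕ) (f : ℕ → ℕ), 2 ≤ n ∧ Set.InjOn f ↑(Finset.range n) ∧
    B.verts = (Finset.range n).image f ∧
    B.arcs = (Finset.range n).image (fun i => (f i, f ((i + 1) % n)))

/-- `B` is a bidirected cycle of length `n`. -/
def IsBidirCycle (B : Digr) (n : ℕ) : Prop :=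
  ∃ f : ℕ → ℕ, Set.InjOn f ↑(Finset.range n) ∧
    B.verts = (Finset.range n).image f ∧
    B.arcs = (Finset.range n).image (fun i => (f i, f ((i + 1) % n))) ∪
      (Finset.range n).image (fun i => (f ((i + 1) % n), f i))

/-- `B` is a bidirected complete graph: every ordered pair of distinct vertices is an arc. -/
def IsBidirComplete (B : Digr) : Prop :=
  B.arcs = (B.verts ×ˢ B.verts).filter (fun a => a.1 ≠ a.2)

/-- `D` contains a bidirected complete graph on `k` vertices as a subdigraph. -/
def ContainsK (k : ℕ) (D : Digr) : Prop :=
  ∃ S : Finset ℕ, S ⊆ D.verts ∧ S.card = k ∧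
    ∀ x ∈ S, ∀ y ∈ S, x ≠ y → (x, y) ∈ D.arcs

/-- `D` is the Dirac join of the disjoint digraphs `D1` and `D2`: their union
together with all arcs in both directions between them. -/
def IsDiracJoin (D D1 D2 : Digr) : Prop :=
  Disjoint D1.verts D2.verts ∧
  D.verts = D1.verts ∪ D2.verts ∧
  D.arcs = D1.arcs ∪ D2.arcs ∪ D1.verts ×ˢ D2.verts ∪ D2.verts ×ˢ D1.verts

/-- `D` is the directed Hajós join `(D1, v1, u1) ▽ (D2, v2, u2)` of the disjoint
digraphs `D1` and `D2`: delete the arcs `u1v1` and `v2u2`, identify `v1` and `v2`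
(the merged vertex is represented by `v1`), and add the arc `u1u2`. -/
def IsHajosJoin (D D1 D2 : Digr) (u1 v1 v2 u2 : ℕ) : Prop :=
  Disjoint D1.verts D2.verts ∧
  (u1, v1) ∈ D1.arcs ∧ (v2, u2) ∈ D2.arcs ∧
  D.verts = D1.verts ∪ D2.verts.erase v2 ∧
  D.arcs = D1.arcs.erase (u1, v1) ∪
      (D2.arcs.erase (v2, u2)).image
        (Prod.map (fun x => if x = v2 then v1 else x) (fun x => if x = v2 then v1 else x)) ∪
      {(u1, u2)}

/-- `D` is the bidirected Hajós join `(D1, v1, u1) ▽̄ (D2, v2, u2)` of the disjoint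
digraphs `D1` and `D2`: delete both arcs of the digon between `u1` and `v1` and both
arcs of the digon between `u2` and `v2`, identify `v1` and `v2` (the merged vertex is
represented by `v1`), and add both arcs `u1u2` and `u2u1`. -/
def IsBidirHajosJoin (D D1 D2 : Digr) (u1 v1 v2 u2 : ℕ) : Prop :=
  Disjoint D1.verts D2.verts ∧
  (u1, v1) ∈ D1.arcs ∧ (v1, u1) ∈ D1.arcs ∧
  (u2, v2) ∈ D2.arcs ∧ (v2, u2) ∈ D2.arcs ∧
  D.verts = D1.verts ∪ D2.verts.erase v2 ∧
  D.arcs = ((D1.arcs.erase (u1, v1)).erase (v1, u1)) ∪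
      (((D2.arcs.erase (v2, u2)).erase (u2, v2)).image
        (Prod.map (fun x => if x = v2 then v1 else x) (fun x => if x = v2 then v1 else x))) ∪
      {(u1, u2), (u2, u1)}

/-- `D'` is obtained from `D` by identifying the non-empty independent set `I`
with the (new) vertex `v`. -/
def IsIdent (D' D : Digr) (I : Finset ℕ) (v : ℕ) : Prop :=
  I.Nonempty ∧ I ⊆ D.verts ∧
  (∀ x ∈ I, ∀ y ∈ I, (x, y) ∉ D.arcs) ∧
  (v ∈ I ∨ v ∉ D.verts) ∧
  D'.verts = (D.verts \ I) ∪ {v} ∧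
  D'.arcs = D.arcs.filter (fun a => a.1 ∉ I ∧ a.2 ∉ I) ∪
      (D.arcs.filter (fun a => a.1 ∈ I ∧ a.2 ∉ I)).image (fun a => (v, a.2)) ∪
      (D.arcs.filter (fun a => a.1 ∉ I ∧ a.2 ∈ I)).image (fun a => (a.1, v))

/-- Isomorphism of digraphs. -/
def Iso (D D' : Digr) : Prop :=
  ∃ f : ℕ → ℕ, Set.BijOn f ↑D.verts ↑D'.verts ∧
    ∀ x ∈ D.verts, ∀ y ∈ D.verts, ((x, y) ∈ D.arcs ↔ (f x, f y) ∈ D'.arcs)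

/-- The Hajós-`k`-constructible digraphs: the smallest family of digraphs (closed
under isomorphism) containing the bidirected complete graph on `k` vertices and
closed under directed Hajós joins and identification of independent sets. -/
inductive HajosConstr (k : ℕ) : Digr → Prop
  | base (D : Digr) : D.verts.card = k → D.IsBidirComplete → HajosConstr k D
  | join (D D1 D2 : Digr) (u1 v1 v2 u2 : ℕ) :
      HajosConstr k D1 → HajosConstr k D2 →
      IsHajosJoin D D1 D2 u1 v1 v2 u2 → HajosConstr k D
  | ident (D' D : Digr) (I : Finset ℕ) (v : ℕ) :
      HajosConstr k D → IsIdent D' D I v → HajosConstr k D'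
  | iso (D D' : Digr) : HajosConstr k D → Iso D D' → HajosConstr k D'

/-- `D` is a directed Ore join of the disjoint digraphs `D1` and `D2`: a directed
Hajós join followed by identifying each `w` in a set `A1 ⊆ V(D1 - v1)` with `ι w`,
where `ι` is a bijection from `A1` onto a subset of `V(D2 - v2)` with `ι u1 ≠ u2`. -/
def IsOreJoin (D D1 D2 : Digr) (u1 v1 v2 u2 : ℕ) : Prop :=
  ∃ (H : Digr) (A1 : Finset ℕ) (ι : ℕ → ℕ),
    IsHajosJoin H D1 D2 u1 v1 v2 u2 ∧
    A1 ⊆ D1.verts.erase v1 ∧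
    A1.image ι ⊆ D2.verts.erase v2 ∧
    Set.InjOn ι ↑A1 ∧
    (u1 ∈ A1 → ι u1 ≠ u2) ∧
    D.verts = H.verts.image (fun x => if x ∈ A1 then ι x else x) ∧
    D.arcs = H.arcs.image
      (Prod.map (fun x => if x ∈ A1 then ι x else x) (fun x => if x ∈ A1 then ι x else x))

/-- `D` is a bidirected Ore join of the disjoint digraphs `D1` and `D2`: a bidirected
Hajós join followed by the same kind of identification as in the directed Ore join. -/
def IsBidirOreJoin (D D1 D2 : Digr) (u1 v1 v2 u2 : ℕ) : Prop :=
  ∃ (H : Digr) (A1 : Finset ℕ) (ι : ℕ → ℕ),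
    IsBidirHajosJoin H D1 D2 u1 v1 v2 u2 ∧
    A1 ⊆ D1.verts.erase v1 ∧
    A1.image ι ⊆ D2.verts.erase v2 ∧
    Set.InjOn ι ↑A1 ∧
    (u1 ∈ A1 → ι u1 ≠ u2) ∧
    D.verts = H.verts.image (fun x => if x ∈ A1 then ι x else x) ∧
    D.arcs = H.arcs.image
      (Prod.map (fun x => if x ∈ A1 then ι x else x) (fun x => if x ∈ A1 then ι x else x))

/-- The Ore-`k`-constructible digraphs: the smallest family of digraphs (closed under
isomorphism) containing the bidirected complete graph on `k` vertices and closed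
under directed and bidirected Ore joins. -/
inductive OreConstr (k : ℕ) : Digr → Prop
  | base (D : Digr) : D.verts.card = k → D.IsBidirComplete → OreConstr k D
  | dirJoin (D D1 D2 : Digr) (u1 v1 v2 u2 : ℕ) :
      OreConstr k D1 → OreConstr k D2 →
      IsOreJoin D D1 D2 u1 v1 v2 u2 → OreConstr k D
  | bidirJoin (D D1 D2 : Digr) (u1 v1 v2 u2 : ℕ) :
      OreConstr k D1 → OreConstr k D2 →
      IsBidirOreJoin D D1 D2 u1 v1 v2 u2 → OreConstr k D
  | iso (D D' : Digr) : OreConstr k D → Iso D D' → OreConstr k D'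

/-- The set of low vertices of `D` (for the parameter `k`): the vertices with
out-degree and in-degree both equal to `k - 1`. -/
def lowVerts (D : Digr) (k : ℕ) : Finset ℕ :=
  D.verts.filter (fun v => D.outDeg v = k - 1 ∧ D.inDeg v = k - 1)

end Digr

namespace Digr

/-! ### Colourings -/

lemma good_of_hom {H D : Digr} {n : ℕ} {φ : ℕ → Fin n} (f : ℕ → ℕ)
    (hf : ∀ a ∈ H.arcs, φ (f a.1) ≠ φ (f a.2) ∨ (f a.1, f a.2) ∈ D.arcs)
    (hφ : D.GoodColoring n φ) : H.GoodColoring n (φ ∘ f) := by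
  intro v hv
  refine hφ (f v) (Relation.TransGen.lift f ?_ _ _ hv)
  rintro a b ⟨h1, h2⟩
  rcases hf (a, b) h1 with h | h
  · exact absurd h2 h
  · exact ⟨h, h2⟩

lemma Colorable.mono {D : Digr} {m n : ℕ} (h : m ≤ n) (hD : D.Colorable m) : D.Colorable n := by
  obtain ⟨φ, hφ⟩ := hD
  refine ⟨fun x => Fin.castLE h (φ x), ?_⟩
  intro v hv
  refine hφ v (Relation.TransGen.mono ?_ _ _ hv)
  rintro a b ⟨h1, h2⟩
  exact ⟨h1, Fin.castLE_injective h h2⟩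

/-- A colouring with values in a small set of naturals gives `Colorable`. -/
lemma colorable_of_nat {D : Digr} {n : ℕ} (hn : 0 < n) (f : ℕ → ℕ)
    (hcard : (D.verts.image f).card ≤ n)
    (hf : ∀ v, ¬ Relation.TransGen (fun x y => (x, y) ∈ D.arcs ∧ f x = f y) v v) :
    D.Colorable n := by
  classical
  set S := D.verts.image f
  let e := S.equivFin
  refine ⟨fun x => if h : f x ∈ S then Fin.castLE hcard (e ⟨f x, h⟩) else ⟨0, hn⟩, ?_⟩
  intro v hv
  refine hf v (Relation.TransGen.mono ?_ _ _ hv)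
  rintro a b ⟨h1, h2⟩
  refine ⟨h1, ?_⟩
  have hab := D.arcs_sub _ h1
  have ha : f a ∈ S := Finset.mem_image_of_mem f hab.1
  have hb : f b ∈ S := Finset.mem_image_of_mem f hab.2
  simp only [ha, hb, dif_pos] at h2
  have := e.injective (Fin.castLE_injective hcard h2)
  simpa using this

lemma no_loop (D : Digr) (x : ℕ) : (x, x) ∉ D.arcs := fun h => D.no_loops _ h rfl

lemma exists_colorable (D : Digr) : ∃ n, D.Colorable n := by
  refine ⟨D.verts.card + 1, colorable_of_nat (by omega) id (by simp) ?_⟩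
  intro v hv
  obtain ⟨w, -, h1, h2⟩ := Relation.TransGen.tail'_iff.mp hv
  simp only [id] at h2
  subst h2
  exact D.no_loop _ h1

lemma le_dichrom_iff {k : ℕ} (hk : 1 ≤ k) (D : Digr) :
    k ≤ D.dichrom ↔ ¬ D.Colorable (k - 1) := by
  constructor
  · intro h hc
    have : D.dichrom ≤ k - 1 := Nat.sInf_le hc
    omega
  · intro h
    by_contra hlt
    have h1 : D.Colorable D.dichrom := Nat.sInf_mem D.exists_colorable
    exact h (h1.mono (by omega))

/-! ### Constructible digraphs are not colourable -/

lemma transGen_split {r r' : ℕ → ℕ → Prop} {a b : ℕ}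
    (h : ∀ x y, r x y → r' x y ∨ (x = a ∧ y = b)) {x y : ℕ} (hxy : Relation.TransGen r x y) :
    Relation.TransGen r' x y ∨
      (r a b ∧ Relation.ReflTransGen r' x a ∧ Relation.ReflTransGen r' b y) := by
  induction hxy with
  | single hy =>
    rcases h _ _ hy with h1 | ⟨rfl, rfl⟩
    · exact Or.inl (.single h1)
    · exact Or.inr ⟨hy, .refl, .refl⟩
  | tail _ hyz ih =>
    rcases h _ _ hyz with h1 | ⟨rfl, rfl⟩
    · rcases ih with ih | ⟨h2, h3, h4⟩
      · exact Or.inl (ih.tail h1)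
      · exact Or.inr ⟨h2, h3, h4.tail h1⟩
    · rcases ih with ih | ⟨h2, h3, h4⟩
      · exact Or.inr ⟨hyz, ih.to_reflTransGen, .refl⟩
      · exact Or.inr ⟨h2, h3, .refl⟩

lemma path_of_not_colorable {D : Digr} {n : ℕ} (hD : ¬ D.Colorable n) (φ : ℕ → Fin n)
    (r' : ℕ → ℕ → Prop) (a b : ℕ)
    (h : ∀ x y, (x, y) ∈ D.arcs → φ x = φ y → r' x y ∨ (x = a ∧ y = b))
    (hr' : ∀ x, ¬ Relation.TransGen r' x x) :
    φ a = φ b ∧ Relation.ReflTransGen r' b a := by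
  have : ¬ D.GoodColoring n φ := fun h => hD ⟨φ, h⟩
  simp only [GoodColoring, not_forall, not_not] at this
  obtain ⟨v, hv⟩ := this
  rcases transGen_split (r' := r') (a := a) (b := b) (fun x y hxy => h x y hxy.1 hxy.2) hv
    with h1 | ⟨h1, h2, h3⟩
  · exact absurd h1 (hr' v)
  · exact ⟨h1.2, h3.trans h2⟩

lemma hajos_not_colorable {D D1 D2 : Digr} {u1 v1 v2 u2 n : ℕ}
    (h : IsHajosJoin D D1 D2 u1 v1 v2 u2) (h1 : ¬ D1.Colorable n) (h2 : ¬ D2.Colorable n) :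
    ¬ D.Colorable n := by
  rintro ⟨φ, hφ⟩
  obtain ⟨-, ha1, ha2, -, hA⟩ := h
  have hne : u2 ≠ v2 := fun e => D2.no_loops _ ha2 e.symm
  let p : ℕ → ℕ := fun x => if x = v2 then v1 else x
  obtain ⟨e1, q1⟩ := path_of_not_colorable h1 φ
    (fun x y => (x, y) ∈ D.arcs ∧ φ x = φ y) u1 v1 (by
      intro x y hxy he
      by_cases hc : x = u1 ∧ y = v1
      · exact Or.inr hc
      · left
        refine ⟨?_, he⟩
        rw [hA]
        simp only [Finset.mem_union, Finset.mem_erase, ne_eq, Prod.mk.injEq]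
        exact Or.inl (Or.inl ⟨hc, hxy⟩)) hφ
  obtain ⟨e2, q2⟩ := path_of_not_colorable h2 (φ ∘ p)
    (fun x y => (p x, p y) ∈ D.arcs ∧ φ (p x) = φ (p y)) v2 u2 (by
      intro x y hxy he
      by_cases hc : x = v2 ∧ y = u2
      · exact Or.inr hc
      · left
        refine ⟨?_, he⟩
        rw [hA]
        simp only [Finset.mem_union]
        refine Or.inl (Or.inr ?_)
        refine Finset.mem_image.mpr ⟨(x, y), ?_, rfl⟩
        simp only [Finset.mem_erase, ne_eq, Prod.mk.injEq]
        exact ⟨hc, hxy⟩) (fun x hx => hφ (p x) (Relation.TransGen.lift p (fun _ _ h => h) _ _ hx))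
  have q2' : Relation.ReflTransGen (fun x y => (x, y) ∈ D.arcs ∧ φ x = φ y) (p u2) (p v2) :=
    Relation.ReflTransGen.lift p (fun _ _ h => h) _ _ q2
  have hp1 : p v2 = v1 := by simp [p]
  have hp2 : p u2 = u2 := by simp [p, hne]
  simp only [Function.comp, hp1, hp2] at e2 q2'
  refine hφ u1 (Relation.TransGen.head' (b := u2) ⟨?_, e1.trans e2⟩ (q2'.trans q1))
  rw [hA]; simp

lemma bidirHajos_not_colorable {D D1 D2 : Digr} {u1 v1 v2 u2 n : ℕ}
    (h : IsBidirHajosJoin D D1 D2 u1 v1 v2 u2) (h1 : ¬ D1.Colorable n)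
    (h2 : ¬ D2.Colorable n) : ¬ D.Colorable n := by
  rintro ⟨φ, hφ⟩
  obtain ⟨-, ha1, hb1, ha2, hb2, -, hA⟩ := h
  have hne : u2 ≠ v2 := fun e => D2.no_loops _ ha2 e
  let p : ℕ → ℕ := fun x => if x = v2 then v1 else x
  have hp1 : p v2 = v1 := by simp [p]
  have hp2 : p u2 = u2 := by simp [p, hne]
  have e1 : φ u1 = φ v1 := by
    by_contra hc
    refine h1 ⟨φ ∘ id, good_of_hom (D := D) id ?_ hφ⟩
    rintro ⟨x, y⟩ hxy
    by_cases hx : x = u1 ∧ y = v1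
    · left; rw [hx.1, hx.2]; exact hc
    by_cases hy : x = v1 ∧ y = u1
    · left; rw [hy.1, hy.2]; exact Ne.symm hc
    right
    rw [hA]
    simp only [Finset.mem_union, Finset.mem_erase, ne_eq, Prod.mk.injEq, id]
    exact Or.inl (Or.inl ⟨hy, hx, hxy⟩)
  have e2 : φ u2 = φ v1 := by
    by_contra hc
    refine h2 ⟨φ ∘ p, good_of_hom (D := D) p ?_ hφ⟩
    rintro ⟨x, y⟩ hxy
    by_cases hx : x = u2 ∧ y = v2
    · left; simp only [hx.1, hx.2, hp1, hp2]; exact hc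
    by_cases hy : x = v2 ∧ y = u2
    · left; simp only [hy.1, hy.2, hp1, hp2]; exact Ne.symm hc
    right
    rw [hA]
    simp only [Finset.mem_union]
    refine Or.inl (Or.inr ?_)
    refine Finset.mem_image.mpr ⟨(x, y), ?_, rfl⟩
    simp only [Finset.mem_erase, ne_eq, Prod.mk.injEq]
    exact ⟨hx, hy, hxy⟩
  refine hφ u1 ((Relation.TransGen.single (b := u2) ⟨?_, e1.trans e2.symm⟩).tail
    ⟨?_, e2.trans e1.symm⟩)
  · rw [hA]; simp
  · rw [hA]; simp

lemma not_colorable_of_hom {H D : Digr} {n : ℕ} (f : ℕ → ℕ)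
    (hf : ∀ a ∈ H.arcs, (f a.1, f a.2) ∈ D.arcs) (hH : ¬ H.Colorable n) :
    ¬ D.Colorable n := by
  rintro ⟨φ, hφ⟩
  exact hH ⟨φ ∘ f, good_of_hom f (fun a ha => Or.inr (hf a ha)) hφ⟩

lemma not_colorable_of_oreConstr {k : ℕ} (hk : 3 ≤ k) {D : Digr} (h : OreConstr k D) :
    ¬ D.Colorable (k - 1) := by
  induction h with
  | base D hc hD =>
    rintro ⟨φ, hφ⟩
    obtain ⟨x, hx, y, hy, hxy, he⟩ := Finset.exists_ne_map_eq_of_card_lt_of_maps_to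
      (s := D.verts) (t := (Finset.univ : Finset (Fin (k - 1)))) (f := φ)
      (by simp; omega) (by intro a _; simp)
    have m : ∀ a ∈ D.verts, ∀ b ∈ D.verts, a ≠ b → (a, b) ∈ D.arcs := by
      intro a ha b hb hab
      rw [hD]; simp [ha, hb, hab]
    exact hφ x ((Relation.TransGen.single ⟨m x hx y hy hxy, he⟩).tail
      ⟨m y hy x hx hxy.symm, he.symm⟩)
  | dirJoin D D1 D2 u1 v1 v2 u2 _ _ hJ ih1 ih2 =>
    obtain ⟨H, A1, ι, hH, -, -, -, -, -, hA⟩ := hJ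
    refine not_colorable_of_hom (fun x => if x ∈ A1 then ι x else x) ?_
      (hajos_not_colorable hH ih1 ih2)
    intro a ha
    rw [hA]
    exact Finset.mem_image.mpr ⟨a, ha, rfl⟩
  | bidirJoin D D1 D2 u1 v1 v2 u2 _ _ hJ ih1 ih2 =>
    obtain ⟨H, A1, ι, hH, -, -, -, -, -, hA⟩ := hJ
    refine not_colorable_of_hom (fun x => if x ∈ A1 then ι x else x) ?_
      (bidirHajos_not_colorable hH ih1 ih2)
    intro a ha
    rw [hA]
    exact Finset.mem_image.mpr ⟨a, ha, rfl⟩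
  | iso D D' _ hI ih =>
    obtain ⟨f, -, hf⟩ := hI
    refine not_colorable_of_hom f ?_ ih
    rintro ⟨x, y⟩ ha
    have := D.arcs_sub _ ha
    exact (hf x this.1 y this.2).mp ha

/-! ### Ore joins of overlapping digraphs -/

/-- Image of a digraph under an injective map. -/
def mapInj (D : Digr) (f : ℕ → ℕ) (hf : Set.InjOn f ↑D.verts) : Digr where
  verts := D.verts.image f
  arcs := D.arcs.image (Prod.map f f)
  arcs_sub := by
    intro a ha
    obtain ⟨b, hb, rfl⟩ := Finset.mem_image.mp ha
    have := D.arcs_sub b hb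
    exact ⟨Finset.mem_image_of_mem f this.1, Finset.mem_image_of_mem f this.2⟩
  no_loops := by
    intro a ha
    obtain ⟨b, hb, rfl⟩ := Finset.mem_image.mp ha
    have := D.arcs_sub b hb
    intro he
    exact D.no_loops b hb (hf this.1 this.2 he)

lemma iso_mapInj (D : Digr) (f : ℕ → ℕ) (hf : Set.InjOn f ↑D.verts) :
    Iso D (D.mapInj f hf) := by
  refine ⟨f, ?_, ?_⟩
  · simp only [mapInj, Finset.coe_image]
    exact hf.bijOn_image
  · intro x hx y hy
    simp only [mapInj, Finset.mem_image, Prod.map, Prod.mk.injEq, Prod.exists]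
    constructor
    · intro h; exact ⟨x, y, h, rfl, rfl⟩
    · rintro ⟨a, b, h, h1, h2⟩
      have := D.arcs_sub _ h
      rwa [← hf this.1 hx h1, ← hf this.2 hy h2]

lemma Iso.of_mapInj (D : Digr) (f : ℕ → ℕ) (hf : Set.InjOn f ↑D.verts) :
    Iso (D.mapInj f hf) D := by
  have hinv : ∀ x ∈ D.verts, Function.invFunOn f ↑D.verts (f x) = x := fun x hx =>
    hf.leftInvOn_invFunOn hx
  refine ⟨Function.invFunOn f ↑D.verts, ?_, ?_⟩
  · simp only [mapInj, Finset.coe_image]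
    refine ⟨?_, ?_, ?_⟩
    · rintro _ ⟨x, hx, rfl⟩
      rw [hinv x hx]; exact hx
    · rintro _ ⟨x, hx, rfl⟩ _ ⟨y, hy, rfl⟩ h
      rw [hinv x hx, hinv y hy] at h
      rw [h]
    · intro x hx
      exact ⟨f x, ⟨x, hx, rfl⟩, hinv x hx⟩
  · intro x hx y hy
    obtain ⟨x, hx', rfl⟩ := Finset.mem_image.mp hx
    obtain ⟨y, hy', rfl⟩ := Finset.mem_image.mp hy
    clear hx hy
    rename' hx' => hx, hy' => hy
    rw [hinv x hx, hinv y hy]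
    simp only [mapInj, Finset.mem_image, Prod.map, Prod.mk.injEq, Prod.exists]
    constructor
    · rintro ⟨a, b, h, h1, h2⟩
      have := D.arcs_sub _ h
      rwa [← hf this.1 hx h1, ← hf this.2 hy h2]
    · intro h; exact ⟨x, y, h, rfl, rfl⟩

lemma exists_bound (S : Finset ℕ) : ∃ N, ∀ x ∈ S, x < N :=
  ⟨S.sup id + 1, fun x hx => Nat.lt_succ_of_le (Finset.le_sup (f := id) hx)⟩

lemma fst_mem {D : Digr} {x y : ℕ} (h : (x, y) ∈ D.arcs) : x ∈ D.verts := (D.arcs_sub _ h).1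
lemma snd_mem {D : Digr} {x y : ℕ} (h : (x, y) ∈ D.arcs) : y ∈ D.verts := (D.arcs_sub _ h).2

lemma oreConstr_dir {k : ℕ} {D D1 D2 : Digr} {u1 v u2 : ℕ}
    (h1 : OreConstr k D1) (h2 : OreConstr k D2)
    (a1 : (u1, v) ∈ D1.arcs) (a2 : (v, u2) ∈ D2.arcs) (hne : u1 ≠ u2)
    (hV : D.verts = D1.verts ∪ D2.verts)
    (hA : D.arcs = D1.arcs.erase (u1, v) ∪ D2.arcs.erase (v, u2) ∪ {(u1, u2)}) :
    OreConstr k D := by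
  classical
  obtain ⟨N, hN⟩ := exists_bound (D1.verts ∪ D2.verts)
  have hN1 : ∀ x ∈ D1.verts, x < N := fun x hx => hN x (Finset.mem_union_left _ hx)
  have hN2 : ∀ x ∈ D2.verts, x < N := fun x hx => hN x (Finset.mem_union_right _ hx)
  let s : ℕ → ℕ := fun x => x + N
  have hs : Set.InjOn s ↑D1.verts := fun x _ y _ h => Nat.add_right_cancel h
  let r : ℕ → ℕ := fun x => if x ∈ D2.verts.erase v then x else x + N
  have hr : Set.InjOn r ↑D.verts := by
    intro x hx y hy h
    rw [hV] at hx hy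
    have := hN x hx
    have := hN y hy
    simp only [r] at h
    split_ifs at h <;> omega
  let p : ℕ → ℕ := fun x => if x = v then v + N else x
  have u1m := fst_mem a1
  have vm1 := snd_mem a1
  have vm2 := fst_mem a2
  have u2m := snd_mem a2
  have hu1 : u1 ≠ v := D1.no_loops _ a1
  have hu2 : v ≠ u2 := D2.no_loops _ a2
  let H : Digr :=
    { verts := (D1.mapInj s hs).verts ∪ D2.verts.erase v
      arcs := (D1.mapInj s hs).arcs.erase (s u1, s v) ∪
        (D2.arcs.erase (v, u2)).image (Prod.map p p) ∪ {(s u1, u2)}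
      arcs_sub := by
        intro a ha
        simp only [Finset.mem_union, Finset.mem_singleton] at ha
        rcases ha with (ha | ha) | ha
        · have := (D1.mapInj s hs).arcs_sub a (Finset.mem_of_mem_erase ha)
          exact ⟨Finset.mem_union_left _ this.1, Finset.mem_union_left _ this.2⟩
        · obtain ⟨b, hb, rfl⟩ := Finset.mem_image.mp ha
          have := D2.arcs_sub b (Finset.mem_of_mem_erase hb)
          have key : ∀ x ∈ D2.verts, p x ∈ (D1.mapInj s hs).verts ∪ D2.verts.erase v := by
            intro x hx
            simp only [p]
            split_ifs with h
            · exact Finset.mem_union_left _ (Finset.mem_image_of_mem s vm1)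
            · exact Finset.mem_union_right _ (Finset.mem_erase.mpr ⟨h, hx⟩)
          exact ⟨key _ this.1, key _ this.2⟩
        · subst ha
          exact ⟨Finset.mem_union_left _ (Finset.mem_image_of_mem s u1m),
            Finset.mem_union_right _ (Finset.mem_erase.mpr ⟨hu2.symm, u2m⟩)⟩
      no_loops := by
        intro a ha
        simp only [Finset.mem_union, Finset.mem_singleton] at ha
        rcases ha with (ha | ha) | ha
        · exact (D1.mapInj s hs).no_loops a (Finset.mem_of_mem_erase ha)
        · obtain ⟨b, hb, rfl⟩ := Finset.mem_image.mp ha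
          have hb := Finset.mem_of_mem_erase hb
          have := D2.arcs_sub b hb
          have h3 := hN2 _ this.1
          have h4 := hN2 _ this.2
          have := D2.no_loops b hb
          simp only [p, Prod.map]
          split_ifs <;> omega
        · subst ha
          have := hN2 _ u2m
          simp only [s]; omega }
  have key1 : ∀ x ∈ D1.verts, (if s x ∈ ((D1.verts ∩ D2.verts).erase v).image s
      then (s x) - N else s x) = r x := by
    intro x hx
    have : s x ∈ ((D1.verts ∩ D2.verts).erase v).image s ↔ x ∈ D2.verts.erase v := by
      simp [s, hx]
    simp only [this, r, s, Nat.add_sub_cancel]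
  have key2 : ∀ x ∈ D2.verts, (if p x ∈ ((D1.verts ∩ D2.verts).erase v).image s
      then (p x) - N else p x) = r x := by
    intro x hx
    have := hN2 x hx
    by_cases hxv : x = v
    · subst hxv
      simp [p, r, s]
    · have h3 : p x = x := by simp [p, hxv]
      have : x ∉ ((D1.verts ∩ D2.verts).erase v).image s := by
        simp only [s, Finset.mem_image, not_exists, not_and]
        intro y _; omega
      simp [h3, this, r, hxv, hx]
  have hp2 : p u2 = u2 := by simp [p, hu2.symm]
  refine OreConstr.iso (D.mapInj r hr) D ?_ (Iso.of_mapInj D r hr)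
  refine OreConstr.dirJoin _ (D1.mapInj s hs) D2 (s u1) (s v) v u2
    (h1.iso _ _ (iso_mapInj D1 s hs)) h2 ?_
  refine ⟨H, ((D1.verts ∩ D2.verts).erase v).image s, fun x => x - N, ?_, ?_, ?_, ?_, ?_, ?_, ?_⟩
  · refine ⟨?_, ?_, a2, rfl, rfl⟩
    · rw [Finset.disjoint_left]
      intro x hx hx2
      obtain ⟨y, -, rfl⟩ := Finset.mem_image.mp hx
      have := hN2 _ hx2
      simp only [s] at this; omega
    · exact Finset.mem_image.mpr ⟨_, a1, rfl⟩
  · intro x hx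
    simp only [mapInj, s, Finset.mem_image, Finset.mem_erase, Finset.mem_inter] at hx ⊢
    obtain ⟨y, ⟨h3, h4, h5⟩, rfl⟩ := hx
    exact ⟨by omega, y, h4, rfl⟩
  · intro x hx
    simp only [s, Finset.mem_image, Finset.mem_erase, Finset.mem_inter] at hx ⊢
    obtain ⟨_, ⟨y, ⟨h3, h4, h5⟩, rfl⟩, rfl⟩ := hx
    rw [Nat.add_sub_cancel]
    exact ⟨h3, h5⟩
  · intro x hx y hy h
    simp only [s, Finset.coe_image, Set.mem_image] at hx hy
    obtain ⟨x, -, rfl⟩ := hx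
    obtain ⟨y, -, rfl⟩ := hy
    simpa using h
  · intro _
    simpa [s] using hne
  · ext x
    simp only [mapInj, H, hV, Finset.image_union, Finset.image_image]
    have e1 : D1.verts.image ((fun x => if x ∈ ((D1.verts ∩ D2.verts).erase v).image s
      then x - N else x) ∘ s) = D1.verts.image r := Finset.image_congr (fun x hx => key1 x hx)
    have e2 : (D2.verts.erase v).image (fun x => if x ∈ ((D1.verts ∩ D2.verts).erase v).image s
      then x - N else x) = (D2.verts.erase v).image r := Finset.image_congr (fun x hx => by
        have hx' := Finset.mem_erase.mp hx
        have := key2 x hx'.2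
        simpa [p, hx'.1] using this)
    rw [e1, e2, ← Finset.image_union, ← Finset.image_union]
    congr! 2
    ext y
    simp only [Finset.mem_union, Finset.mem_erase]
    by_cases hy : y = v
    · subst hy; simp [vm1]
    · simp [hy]
  · simp only [mapInj, H, hA, Finset.image_union, Finset.image_singleton, Prod.map_apply]
    rw [← key1 u1 u1m, ← key2 u2 u2m, hp2]
    have hse : (D1.arcs.image (Prod.map s s)).erase (s u1, s v)
        = (D1.arcs.erase (u1, v)).image (Prod.map s s) := by
      have : Function.Injective (Prod.map s s) :=
        Function.Injective.prodMap (add_left_injective N) (add_left_injective N)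
      rw [Finset.image_erase this]; rfl
    rw [hse, Finset.image_image, Finset.image_image]
    congr 2
    · refine Finset.image_congr (fun a ha => ?_)
      have := D1.arcs_sub a (Finset.mem_of_mem_erase ha)
      simp only [Prod.map, Function.comp]
      rw [key1 _ this.1, key1 _ this.2]
    · refine Finset.image_congr (fun a ha => ?_)
      have := D2.arcs_sub a (Finset.mem_of_mem_erase ha)
      simp only [Prod.map, Function.comp]
      rw [key2 _ this.1, key2 _ this.2]

lemma oreConstr_bidir {k : ℕ} {D D1 D2 : Digr} {u1 v u2 : ℕ}
    (h1 : OreConstr k D1) (h2 : OreConstr k D2)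
    (a1 : (u1, v) ∈ D1.arcs) (b1 : (v, u1) ∈ D1.arcs)
    (b2 : (u2, v) ∈ D2.arcs) (a2 : (v, u2) ∈ D2.arcs) (hne : u1 ≠ u2)
    (hV : D.verts = D1.verts ∪ D2.verts)
    (hA : D.arcs = (D1.arcs.erase (u1, v)).erase (v, u1) ∪
      (D2.arcs.erase (v, u2)).erase (u2, v) ∪ {(u1, u2), (u2, u1)}) :
    OreConstr k D := by
  classical
  obtain ⟨N, hN⟩ := exists_bound (D1.verts ∪ D2.verts)
  have hN1 : ∀ x ∈ D1.verts, x < N := fun x hx => hN x (Finset.mem_union_left _ hx)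
  have hN2 : ∀ x ∈ D2.verts, x < N := fun x hx => hN x (Finset.mem_union_right _ hx)
  let s : ℕ → ℕ := fun x => x + N
  have hs : Set.InjOn s ↑D1.verts := fun x _ y _ h => Nat.add_right_cancel h
  let r : ℕ → ℕ := fun x => if x ∈ D2.verts.erase v then x else x + N
  have hr : Set.InjOn r ↑D.verts := by
    intro x hx y hy h
    rw [hV] at hx hy
    have := hN x hx
    have := hN y hy
    simp only [r] at h
    split_ifs at h <;> omega
  let p : ℕ → ℕ := fun x => if x = v then v + N else x
  have u1m := fst_mem a1
  have vm1 := snd_mem a1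
  have vm2 := fst_mem a2
  have u2m := snd_mem a2
  have hu1 : u1 ≠ v := D1.no_loops _ a1
  have hu2 : v ≠ u2 := D2.no_loops _ a2
  let H : Digr :=
    { verts := (D1.mapInj s hs).verts ∪ D2.verts.erase v
      arcs := ((D1.mapInj s hs).arcs.erase (s u1, s v)).erase (s v, s u1) ∪
        ((D2.arcs.erase (v, u2)).erase (u2, v)).image (Prod.map p p) ∪
          {(s u1, u2), (u2, s u1)}
      arcs_sub := by
        intro a ha
        simp only [Finset.mem_union, Finset.mem_singleton, Finset.mem_insert] at ha
        have m1 : s u1 ∈ (D1.mapInj s hs).verts ∪ D2.verts.erase v :=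
          Finset.mem_union_left _ (Finset.mem_image_of_mem s u1m)
        have m2 : u2 ∈ (D1.mapInj s hs).verts ∪ D2.verts.erase v :=
          Finset.mem_union_right _ (Finset.mem_erase.mpr ⟨hu2.symm, u2m⟩)
        rcases ha with (ha | ha) | ha | ha
        · have := (D1.mapInj s hs).arcs_sub a
            (Finset.mem_of_mem_erase (Finset.mem_of_mem_erase ha))
          exact ⟨Finset.mem_union_left _ this.1, Finset.mem_union_left _ this.2⟩
        · obtain ⟨b, hb, rfl⟩ := Finset.mem_image.mp ha
          have := D2.arcs_sub b (Finset.mem_of_mem_erase (Finset.mem_of_mem_erase hb))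
          have key : ∀ x ∈ D2.verts, p x ∈ (D1.mapInj s hs).verts ∪ D2.verts.erase v := by
            intro x hx
            simp only [p]
            split_ifs with h
            · exact Finset.mem_union_left _ (Finset.mem_image_of_mem s vm1)
            · exact Finset.mem_union_right _ (Finset.mem_erase.mpr ⟨h, hx⟩)
          exact ⟨key _ this.1, key _ this.2⟩
        · subst ha
          exact ⟨m1, m2⟩
        · subst ha
          exact ⟨m2, m1⟩
      no_loops := by
        intro a ha
        simp only [Finset.mem_union, Finset.mem_singleton, Finset.mem_insert] at ha
        have := hN2 _ u2m
        rcases ha with (ha | ha) | ha | ha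
        · exact (D1.mapInj s hs).no_loops a
            (Finset.mem_of_mem_erase (Finset.mem_of_mem_erase ha))
        · obtain ⟨b, hb, rfl⟩ := Finset.mem_image.mp ha
          have hb := Finset.mem_of_mem_erase (Finset.mem_of_mem_erase hb)
          have := D2.arcs_sub b hb
          have h3 := hN2 _ this.1
          have h4 := hN2 _ this.2
          have := D2.no_loops b hb
          simp only [p, Prod.map]
          split_ifs <;> omega
        · subst ha
          simp only [s]; omega
        · subst ha
          simp only [s]; omega }
  have key1 : ∀ x ∈ D1.verts, (if s x ∈ ((D1.verts ∩ D2.verts).erase v).image s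
      then (s x) - N else s x) = r x := by
    intro x hx
    have : s x ∈ ((D1.verts ∩ D2.verts).erase v).image s ↔ x ∈ D2.verts.erase v := by
      simp [s, hx]
    simp only [this, r, s, Nat.add_sub_cancel]
  have key2 : ∀ x ∈ D2.verts, (if p x ∈ ((D1.verts ∩ D2.verts).erase v).image s
      then (p x) - N else p x) = r x := by
    intro x hx
    have := hN2 x hx
    by_cases hxv : x = v
    · subst hxv
      simp [p, r, s]
    · have h3 : p x = x := by simp [p, hxv]
      have : x ∉ ((D1.verts ∩ D2.verts).erase v).image s := by
        simp only [s, Finset.mem_image, not_exists, not_and]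
        intro y _; omega
      simp [h3, this, r, hxv, hx]
  have hp2 : p u2 = u2 := by simp [p, hu2.symm]
  refine OreConstr.iso (D.mapInj r hr) D ?_ (Iso.of_mapInj D r hr)
  refine OreConstr.bidirJoin _ (D1.mapInj s hs) D2 (s u1) (s v) v u2
    (h1.iso _ _ (iso_mapInj D1 s hs)) h2 ?_
  refine ⟨H, ((D1.verts ∩ D2.verts).erase v).image s, fun x => x - N, ?_, ?_, ?_, ?_, ?_, ?_, ?_⟩
  · refine ⟨?_, ?_, ?_, b2, a2, rfl, rfl⟩
    · rw [Finset.disjoint_left]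
      intro x hx hx2
      obtain ⟨y, -, rfl⟩ := Finset.mem_image.mp hx
      have := hN2 _ hx2
      simp only [s] at this; omega
    · exact Finset.mem_image.mpr ⟨_, a1, rfl⟩
    · exact Finset.mem_image.mpr ⟨_, b1, rfl⟩
  · intro x hx
    simp only [mapInj, s, Finset.mem_image, Finset.mem_erase, Finset.mem_inter] at hx ⊢
    obtain ⟨y, ⟨h3, h4, h5⟩, rfl⟩ := hx
    exact ⟨by omega, y, h4, rfl⟩
  · intro x hx
    simp only [s, Finset.mem_image, Finset.mem_erase, Finset.mem_inter] at hx ⊢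
    obtain ⟨_, ⟨y, ⟨h3, h4, h5⟩, rfl⟩, rfl⟩ := hx
    rw [Nat.add_sub_cancel]
    exact ⟨h3, h5⟩
  · intro x hx y hy h
    simp only [s, Finset.coe_image, Set.mem_image] at hx hy
    obtain ⟨x, -, rfl⟩ := hx
    obtain ⟨y, -, rfl⟩ := hy
    simpa using h
  · intro _
    simpa [s] using hne
  · ext x
    simp only [mapInj, H, hV, Finset.image_union, Finset.image_image]
    have e1 : D1.verts.image ((fun x => if x ∈ ((D1.verts ∩ D2.verts).erase v).image s
      then x - N else x) ∘ s) = D1.verts.image r := Finset.image_congr (fun x hx => key1 x hx)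
    have e2 : (D2.verts.erase v).image (fun x => if x ∈ ((D1.verts ∩ D2.verts).erase v).image s
      then x - N else x) = (D2.verts.erase v).image r := Finset.image_congr (fun x hx => by
        have hx' := Finset.mem_erase.mp hx
        have := key2 x hx'.2
        simpa [p, hx'.1] using this)
    rw [e1, e2, ← Finset.image_union, ← Finset.image_union]
    congr! 2
    ext y
    simp only [Finset.mem_union, Finset.mem_erase]
    by_cases hy : y = v
    · subst hy; simp [vm1]
    · simp [hy]
  · simp only [mapInj, H, hA, Finset.image_union, Finset.image_insert, Finset.image_singleton,
      Prod.map_apply]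
    rw [← key1 u1 u1m, ← key2 u2 u2m, hp2]
    have hse : ((D1.arcs.image (Prod.map s s)).erase (s u1, s v)).erase (s v, s u1)
        = ((D1.arcs.erase (u1, v)).erase (v, u1)).image (Prod.map s s) := by
      have : Function.Injective (Prod.map s s) :=
        Function.Injective.prodMap (add_left_injective N) (add_left_injective N)
      rw [Finset.image_erase this, Finset.image_erase this]; rfl
    rw [hse, Finset.image_image, Finset.image_image]
    congr 2
    · refine Finset.image_congr (fun a ha => ?_)
      have := D1.arcs_sub a (Finset.mem_of_mem_erase (Finset.mem_of_mem_erase ha))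
      simp only [Prod.map, Function.comp]
      rw [key1 _ this.1, key1 _ this.2]
    · refine Finset.image_congr (fun a ha => ?_)
      have := D2.arcs_sub a (Finset.mem_of_mem_erase (Finset.mem_of_mem_erase ha))
      simp only [Prod.map, Function.comp]
      rw [key2 _ this.1, key2 _ this.2]

/-! ### Complete digraphs -/

/-- The bidirected complete digraph on `V`. -/
def complete (V : Finset ℕ) : Digr where
  verts := V
  arcs := (V ×ˢ V).filter (fun a => a.1 ≠ a.2)
  arcs_sub := by
    intro a ha
    simp only [Finset.mem_filter, Finset.mem_product] at ha
    exact ha.1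
  no_loops := by
    intro a ha
    simp only [Finset.mem_filter, Finset.mem_product] at ha
    exact ha.2

lemma mem_complete {V : Finset ℕ} {x y : ℕ} :
    (x, y) ∈ (complete V).arcs ↔ x ∈ V ∧ y ∈ V ∧ x ≠ y := by
  simp [complete, and_assoc]

lemma complete_verts (V : Finset ℕ) : (complete V).verts = V := rfl

lemma complete_step {k n : ℕ} (hn : 3 ≤ n)
    (ih : ∀ V : Finset ℕ, V.card = n → OreConstr k (complete V))
    (V : Finset ℕ) (hV : V.card = n + 1) : OreConstr k (complete V) := by
  obtain ⟨T, hTV, hT⟩ := Finset.exists_subset_card_eq (s := V) (n := 3) (by omega)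
  obtain ⟨v, x, y, hvx, hvy, hxy, rfl⟩ := Finset.card_eq_three.mp hT
  have hv : v ∈ V := hTV (by simp)
  have hx : x ∈ V := hTV (by simp)
  have hy : y ∈ V := hTV (by simp)
  obtain ⟨c, hc, hcT⟩ : ∃ c ∈ V, c ∉ ({v, x, y} : Finset ℕ) := by
    by_contra! h
    have := Finset.card_le_card (show V ⊆ _ from h)
    omega
  simp only [Finset.mem_insert, Finset.mem_singleton, not_or] at hcT
  obtain ⟨hcv, hcx, hcy⟩ := hcT
  let J : Digr :=
    { verts := V
      arcs := (complete (V.erase y)).arcs.erase (x, v) ∪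
        (complete (V.erase x)).arcs.erase (v, y) ∪ {(x, y)}
      arcs_sub := by
        rintro ⟨a, b⟩ hab
        simp only [Finset.mem_union, Finset.mem_erase, mem_complete, Finset.mem_singleton,
          Prod.mk.injEq] at hab
        grind
      no_loops := by
        rintro ⟨a, b⟩ hab
        simp only [Finset.mem_union, Finset.mem_erase, mem_complete, Finset.mem_singleton,
          Prod.mk.injEq] at hab
        grind }
  have hJ : OreConstr k J := by
    refine oreConstr_dir (D1 := complete (V.erase y)) (D2 := complete (V.erase x))
      (u1 := x) (v := v) (u2 := y) (ih _ ?_) (ih _ ?_) ?_ ?_ hxy ?_ rfl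
    · rw [Finset.card_erase_of_mem hy, hV]; omega
    · rw [Finset.card_erase_of_mem hx, hV]; omega
    · rw [mem_complete]; grind
    · rw [mem_complete]; grind
    · simp only [complete_verts, J]; ext z; grind
  have mJ : ∀ a b, (a, b) ∈ J.arcs ↔ ((¬ (a = x ∧ b = v) ∧ a ∈ V.erase y ∧ b ∈ V.erase y ∧ a ≠ b) ∨
      (¬ (a = v ∧ b = y) ∧ a ∈ V.erase x ∧ b ∈ V.erase x ∧ a ≠ b)) ∨ (a = x ∧ b = y) := by
    intro a b
    simp only [J, Finset.mem_union, Finset.mem_erase, mem_complete, Finset.mem_singleton,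
          Prod.mk.injEq, ne_eq]
  refine oreConstr_dir (D1 := J) (D2 := complete (V.erase c))
      (u1 := v) (v := x) (u2 := y) hJ (ih _ ?_) ?_ ?_ hvy ?_ ?_
  · rw [Finset.card_erase_of_mem hc, hV]; omega
  · rw [mJ]; grind
  · rw [mem_complete]; grind
  · simp only [complete_verts, J]; ext z; grind
  · ext ⟨a, b⟩
    simp only [Finset.mem_union, Finset.mem_erase, mem_complete, Finset.mem_singleton,
          Prod.mk.injEq, mJ, ne_eq]
    grind

lemma oreConstr_complete {k : ℕ} (hk : 3 ≤ k) (V : Finset ℕ) (hV : k ≤ V.card) :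
    OreConstr k (complete V) := by
  have : ∀ n, k ≤ n → ∀ V : Finset ℕ, V.card = n → OreConstr k (complete V) := by
    intro n hn
    induction n, hn using Nat.le_induction with
    | base => intro V hV; exact .base _ hV rfl
    | succ n hn ih => exact complete_step (by omega) ih
  exact this _ hV V rfl

/-! ### Non-colourable digraphs are constructible -/

/-- Add a set of arcs, restricted to legal ones. -/
def addArcs (D : Digr) (F : Finset (ℕ × ℕ)) : Digr where
  verts := D.verts
  arcs := D.arcs ∪ F.filter (fun a => a.1 ∈ D.verts ∧ a.2 ∈ D.verts ∧ a.1 ≠ a.2)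
  arcs_sub := by
    intro a ha
    simp only [Finset.mem_union, Finset.mem_filter] at ha
    rcases ha with ha | ha
    · exact D.arcs_sub a ha
    · exact ⟨ha.2.1, ha.2.2.1⟩
  no_loops := by
    intro a ha
    simp only [Finset.mem_union, Finset.mem_filter] at ha
    rcases ha with ha | ha
    · exact D.no_loops a ha
    · exact ha.2.2.2

lemma oreConstr_of_not_colorable {k : ℕ} (hk : 3 ≤ k) (D : Digr)
    (hD : ¬ D.Colorable (k - 1)) : OreConstr k D := by
  classical
  induction hm : ((complete D.verts).arcs \ D.arcs).card using Nat.strong_induction_on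
    generalizing D with
  | _ m ih =>
  by_contra hcon
  have hsub : ∀ x y, (x, y) ∈ D.arcs → x ∈ D.verts ∧ y ∈ D.verts ∧ x ≠ y := fun x y h =>
    ⟨fst_mem h, snd_mem h, D.no_loops _ h⟩
  -- adding missing arcs yields constructible digraphs
  have addC : ∀ F : Finset (ℕ × ℕ), ∀ x y, x ∈ D.verts → y ∈ D.verts → x ≠ y → (x, y) ∈ F →
      (x, y) ∉ D.arcs → OreConstr k (D.addArcs F) := by
    intro F x y hx hy hxy hF hn
    refine ih _ ?_ (D.addArcs F) ?_ rfl
    · rw [← hm]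
      apply Finset.card_lt_card
      rw [Finset.ssubset_iff_of_subset]
      · refine ⟨(x, y), ?_, ?_⟩
        · simp [mem_complete, hx, hy, hxy, hn]
        · simp [addArcs, hx, hy, hxy, hF]
      · intro a ha
        simp only [addArcs, Finset.mem_sdiff, Finset.mem_union, not_or] at ha ⊢
        exact ⟨ha.1, ha.2.1⟩
    · refine not_colorable_of_hom id ?_ hD
      intro a ha
      exact Finset.mem_union_left _ ha
  -- transitivity of non-arcs
  have T1 : ∀ x ∈ D.verts, ∀ y ∈ D.verts, ∀ z ∈ D.verts, (x, y) ∉ D.arcs → (y, z) ∉ D.arcs →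
      (x, z) ∉ D.arcs := by
    intro x hx y hy z hz hxy hyz hxz
    have n1 : x ≠ y := by rintro rfl; exact hyz hxz
    have n2 : y ≠ z := by rintro rfl; exact hxy hxz
    have n3 : x ≠ z := D.no_loops _ hxz
    refine hcon (oreConstr_dir (u1 := x) (v := y) (u2 := z)
      (addC {(x, y)} x y hx hy n1 (by simp) hxy) (addC {(y, z)} y z hy hz n2 (by simp) hyz)
      ?_ ?_ n3 ?_ ?_)
    · simp [addArcs, hx, hy, n1]
    · simp [addArcs, hy, hz, n2]
    · simp [addArcs]
    · ext ⟨a, b⟩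
      simp only [addArcs, Finset.mem_union, Finset.mem_erase, Finset.mem_filter,
        Finset.mem_singleton, Prod.mk.injEq, ne_eq]
      grind
  -- transitivity of non-digons
  have T2 : ∀ x ∈ D.verts, ∀ y ∈ D.verts, ∀ z ∈ D.verts, ¬ ((x, y) ∈ D.arcs ∧ (y, x) ∈ D.arcs) →
      ¬ ((y, z) ∈ D.arcs ∧ (z, y) ∈ D.arcs) → ¬ ((x, z) ∈ D.arcs ∧ (z, x) ∈ D.arcs) := by
    rintro x hx y hy z hz hxy hyz ⟨hxz, hzx⟩
    have n1 : x ≠ y := by rintro rfl; exact hyz ⟨hxz, hzx⟩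
    have n2 : y ≠ z := by rintro rfl; exact hxy ⟨hxz, hzx⟩
    have n3 : x ≠ z := D.no_loops _ hxz
    have addTwo : ∀ a ∈ D.verts, ∀ b ∈ D.verts, a ≠ b → ¬ ((a, b) ∈ D.arcs ∧ (b, a) ∈ D.arcs) →
        OreConstr k (D.addArcs {(a, b), (b, a)}) := by
      intro a ha b hb hab hn
      by_cases h : (a, b) ∈ D.arcs
      · exact addC _ b a hb ha hab.symm (by simp) (fun h' => hn ⟨h, h'⟩)
      · exact addC _ a b ha hb hab (by simp) h
    refine hcon (oreConstr_bidir (u1 := x) (v := y) (u2 := z)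
      (addTwo x hx y hy n1 hxy) (addTwo y hy z hz n2 hyz) ?_ ?_ ?_ ?_ n3 ?_ ?_)
    · simp [addArcs, hx, hy, n1]
    · simp [addArcs, hx, hy, n1.symm]
    · simp [addArcs, hy, hz, n2.symm]
    · simp [addArcs, hy, hz, n2]
    · simp [addArcs]
    · ext ⟨a, b⟩
      simp only [addArcs, Finset.mem_union, Finset.mem_erase, Finset.mem_filter,
        Finset.mem_insert, Finset.mem_singleton, Prod.mk.injEq, ne_eq]
      constructor
      · intro h
        by_cases c1 : a = x ∧ b = y
        · grind
        by_cases c2 : a = y ∧ b = x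
        · grind
        exact Or.inl (Or.inl ⟨c2, c1, Or.inl h⟩)
      · rintro ((⟨c1, c2, h⟩ | ⟨c1, c2, h⟩) | ⟨rfl, rfl⟩ | ⟨rfl, rfl⟩)
        · tauto
        · tauto
        · exact hxz
        · exact hzx
  -- representatives of the classes
  let cls : ℕ → Finset ℕ := fun x =>
    D.verts.filter (fun y => ¬ ((x, y) ∈ D.arcs ∧ (y, x) ∈ D.arcs))
  have hself : ∀ x ∈ D.verts, x ∈ cls x := by
    intro x hx
    simp [cls, hx, D.no_loop x]
  have hcls : ∀ x ∈ D.verts, ∀ y ∈ D.verts,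
      (cls x = cls y ↔ ¬ ((x, y) ∈ D.arcs ∧ (y, x) ∈ D.arcs)) := by
    intro x hx y hy
    constructor
    · intro h
      have := hself y hy
      rw [← h] at this
      exact (Finset.mem_filter.mp this).2
    · intro h
      ext z
      simp only [cls, Finset.mem_filter]
      constructor
      · rintro ⟨hz, h1⟩
        exact ⟨hz, T2 y hy x hx z hz (fun h' => h ⟨h'.2, h'.1⟩) h1⟩
      · rintro ⟨hz, h1⟩
        exact ⟨hz, T2 x hx y hy z hz h h1⟩
  let rep : ℕ → ℕ := fun x => if h : (cls x).Nonempty then (cls x).min' h else x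
  have hrepm : ∀ x ∈ D.verts, rep x ∈ cls x := by
    intro x hx
    have hne : (cls x).Nonempty := ⟨x, hself x hx⟩
    simp only [rep, hne, dif_pos]
    exact Finset.min'_mem _ _
  have hrepv : ∀ x ∈ D.verts, rep x ∈ D.verts := fun x hx =>
    (Finset.mem_filter.mp (hrepm x hx)).1
  have hrepc : ∀ x ∈ D.verts, cls (rep x) = cls x := by
    intro x hx
    exact ((hcls x hx _ (hrepv x hx)).mpr (Finset.mem_filter.mp (hrepm x hx)).2).symm
  have hrepcongr : ∀ x ∈ D.verts, ∀ y ∈ D.verts, cls x = cls y → rep x = rep y := by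
    intro x hx y hy h
    have hne : (cls y).Nonempty := ⟨y, hself y hy⟩
    simp only [rep, h, hne, dif_pos]
  have hrep : ∀ x ∈ D.verts, ∀ y ∈ D.verts,
      (rep x = rep y ↔ ¬ ((x, y) ∈ D.arcs ∧ (y, x) ∈ D.arcs)) := by
    intro x hx y hy
    rw [← hcls x hx y hy]
    refine ⟨fun h => ?_, hrepcongr x hx y hy⟩
    rw [← hrepc x hx, h, hrepc y hy]
  have hreprep : ∀ x ∈ D.verts, rep (rep x) = rep x := fun x hx =>
    hrepcongr _ (hrepv x hx) _ hx (hrepc x hx)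
  -- many classes
  have hmany : k ≤ (D.verts.image rep).card := by
    by_contra hlt
    refine hD (colorable_of_nat (by omega) rep (by omega) ?_)
    have walk : ∀ x y, Relation.TransGen (fun x y => (x, y) ∈ D.arcs ∧ rep x = rep y) x y →
        x ∈ D.verts ∧ y ∈ D.verts ∧ (y, x) ∉ D.arcs := by
      intro x y h
      have step : ∀ a b, (a, b) ∈ D.arcs ∧ rep a = rep b →
          a ∈ D.verts ∧ b ∈ D.verts ∧ (b, a) ∉ D.arcs := by
        rintro a b ⟨h1, h2⟩
        obtain ⟨ha, hb, -⟩ := hsub a b h1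
        exact ⟨ha, hb, fun h3 => (hrep a ha b hb).mp h2 ⟨h1, h3⟩⟩
      induction h with
      | single h => exact step _ _ h
      | tail _ h ih2 =>
        obtain ⟨ha, hb, hn⟩ := step _ _ h
        exact ⟨ih2.1, hb, T1 _ hb _ ha _ ih2.1 hn ih2.2.2⟩
    intro v hv
    obtain ⟨w, hvw, hwv, he⟩ := Relation.TransGen.tail'_iff.mp hv
    rcases Relation.reflTransGen_iff_eq_or_transGen.mp hvw with h | h
    · subst h; exact D.no_loop _ hwv
    · exact (walk _ _ h).2.2 hwv
  have hcardV : k ≤ D.verts.card := hmany.trans Finset.card_image_le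
  -- D is not complete
  obtain ⟨x, hx, y, hy, hxy, hnxy⟩ : ∃ x ∈ D.verts, ∃ y ∈ D.verts, x ≠ y ∧ (x, y) ∉ D.arcs := by
    by_contra! hall
    have hDe : D.arcs = (complete D.verts).arcs := by
      ext ⟨a, b⟩
      rw [mem_complete]
      exact ⟨hsub a b, fun h => hall a h.1 b h.2.1 h.2.2⟩
    have : D = complete D.verts := by
      cases D
      simp only [complete, Digr.mk.injEq, true_and] at hDe ⊢
      exact hDe
    exact hcon (this ▸ oreConstr_complete hk D.verts hcardV)
  have hrxy : rep x = rep y := (hrep x hx y hy).mpr (fun h => hnxy h.1)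
  -- a clique of size k through y
  obtain ⟨T, hTs, hTc⟩ := Finset.exists_subset_card_eq
    (s := (D.verts.image rep).erase (rep y)) (n := k - 1) (by
      rw [Finset.card_erase_of_mem (Finset.mem_image_of_mem rep hy)]; omega)
  have hT : ∀ z ∈ T, z ∈ D.verts ∧ rep z = z ∧ z ≠ rep y := by
    intro z hz
    obtain ⟨h1, h2⟩ := Finset.mem_erase.mp (hTs hz)
    obtain ⟨w, hw, rfl⟩ := Finset.mem_image.mp h2
    exact ⟨hrepv w hw, hreprep w hw, h1⟩
  have dig : ∀ a ∈ D.verts, ∀ b ∈ D.verts, rep a ≠ rep b →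
      (a, b) ∈ D.arcs ∧ (b, a) ∈ D.arcs := by
    intro a ha b hb h
    by_contra h'
    exact h ((hrep a ha b hb).mpr h')
  have hyT : y ∉ T := by
    intro h
    obtain ⟨-, h1, h2⟩ := hT y h
    exact h2 h1.symm
  obtain ⟨z, hz⟩ : T.Nonempty := by
    rw [← Finset.card_pos]; omega
  obtain ⟨hzV, hzr, hzy⟩ := hT z hz
  have hxz : (x, z) ∈ D.arcs := (dig x hx z hzV (by rw [hzr, hrxy]; exact hzy.symm)).1
  have hyz : (y, z) ∈ D.arcs := (dig y hy z hzV (by rw [hzr]; exact hzy.symm)).1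
  have hclique : ∀ a b, (a, b) ∈ (complete (insert y T)).arcs → (a, b) ∈ D.arcs := by
    intro a b hab
    rw [mem_complete] at hab
    obtain ⟨ha, hb, hab⟩ := hab
    rw [Finset.mem_insert] at ha hb
    rcases ha with rfl | ha <;> rcases hb with rfl | hb
    · exact absurd rfl hab
    · obtain ⟨h1, h2, h3⟩ := hT b hb
      exact (dig _ hy b h1 (by rw [h2]; exact h3.symm)).1
    · obtain ⟨h1, h2, h3⟩ := hT a ha
      exact (dig a h1 _ hy (by rw [h2]; exact h3)).1
    · obtain ⟨h1, h2, h3⟩ := hT a ha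
      obtain ⟨h4, h5, h6⟩ := hT b hb
      exact (dig a h1 b h4 (by rw [h2, h5]; exact hab)).1
  have hK : OreConstr k (complete (insert y T)) := by
    refine .base _ ?_ rfl
    rw [complete_verts, Finset.card_insert_of_notMem hyT]; omega
  refine hcon (oreConstr_dir (u1 := x) (v := y) (u2 := z)
      (addC {(x, y)} x y hx hy hxy (by simp) hnxy) hK ?_ ?_ (D.no_loops _ hxz) ?_ ?_)
  · simp [addArcs, hx, hy, hxy]
  · rw [mem_complete]
    exact ⟨by simp, by simp [hz], D.no_loops _ hyz⟩
  · have : insert y T ⊆ D.verts := by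
      intro a ha
      rcases Finset.mem_insert.mp ha with rfl | ha
      · exact hy
      · exact (hT a ha).1
    simp only [addArcs, complete_verts]
    exact (Finset.union_eq_left.mpr this).symm
  · ext ⟨a, b⟩
    have := hclique a b
    simp only [addArcs, Finset.mem_union, Finset.mem_erase, Finset.mem_filter,
        Finset.mem_singleton, Prod.mk.injEq, ne_eq]
    grind

end Digr

open Digr in
/-- For `k ≥ 3`, a digraph `D` has dichromatic number at least `k`
iff it is Ore-`k`-constructible. -/
theorem dichromatic_ge_iff_oreConstructible (k : ℕ) (hk : 3 ≤ k) (D : Digr) :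
    k ≤ D.dichrom ↔ OreConstr k D := by
  rw [le_dichrom_iff (by omega)]
  exact ⟨oreConstr_of_not_colorable hk D, not_colorable_of_oreConstr hk⟩
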